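/- Let τ be the vocabulary consisting of two constant symbols 0 and 1. Given a propositional dependence logic formula φ(p₁,…,pₙ), let φ* be the quantifier-free dependence logic formula over τ obtained by replacing each occurrence of a propositional variable p_i by the atom x_{p_i}=1, each occurrence of a negated propositional variable ¬p_i by x_{p_i}=0, and each dependence atom dep(p_{i₁},…,p_{i_r}, p_j) by dep(x_{p_{i₁}},…,x_{p_{i_r}}, x_{p_j}), and define ψ_φ := φ* ∧ ⋀_{i=1}^{n}(x_{p_i}=1 ∨ x_{p_i}=0) ∧ ¬ 0=1. Then for every k ≥ 1: φ is k-coherent (as a PDL formula) if and only if ψ_φ is k-coherent (as a DQF(τ) formula over all τ-structures). -/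

import Mathlib

/-! Propositional dependence logic with team semantics. -/

/-- Formulas of propositional dependence logic over propositional variables `P`. -/
inductive PDL (P : Type) : Type where
  | var (p : P) : PDL P
  | nvar (p : P) : PDL P
  | dep (m : ℕ) (ps : Fin m → P) (q : P) : PDL P
  | and (φ ψ : PDL P) : PDL P
  | or (φ ψ : PDL P) : PDL P

/-- Team semantics for propositional dependence logic: a propositional team is a
set of assignments `P → Bool`. -/
def PSat {P : Type} : Set (P → Bool) → PDL P → Prop
  | T, .var p => ∀ s ∈ T, s p = true
  | T, .nvar p => ∀ s ∈ T, s p = false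
  | T, .dep _ ps q => ∀ s₁ ∈ T, ∀ s₂ ∈ T, (∀ i, s₁ (ps i) = s₂ (ps i)) → s₁ q = s₂ q
  | T, .and φ ψ => PSat T φ ∧ PSat T ψ
  | T, .or φ ψ => ∃ T₁ T₂, T = T₁ ∪ T₂ ∧ PSat T₁ φ ∧ PSat T₂ ψ

/-- `φ` is `k`-coherent: a propositional team satisfies `φ` iff all its subteams
with at most `k` elements do. -/
def PKCoherent {P : Type} (k : ℕ) (φ : PDL P) : Prop :=
  ∀ T : Set (P → Bool), PSat T φ ↔ ∀ S ⊆ T, S.Finite → S.ncard ≤ k → PSat S φ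

/-- Terms over the vocabulary with the two constant symbols `0` (`false`) and
`1` (`true`): a term is a variable or a constant symbol. -/
inductive CTerm (V : Type) : Type where
  | var (v : V) : CTerm V
  | const (b : Bool) : CTerm V

/-- Value of a term under an interpretation `c` of the constants and an assignment `s`. -/
def CTerm.val {V A : Type} (c : Bool → A) (s : V → A) : CTerm V → A
  | .var v => s v
  | .const b => c b

/-- Quantifier-free dependence logic formulas over the vocabulary `τ = {0, 1}`
consisting of two constant symbols. -/
inductive DQFC (V : Type) : Type where
  | eq (t u : CTerm V) : DQFC V
  | neq (t u : CTerm V) : DQFC V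
  | dep (m : ℕ) (ys : Fin m → V) (z : V) : DQFC V
  | and (φ ψ : DQFC V) : DQFC V
  | or (φ ψ : DQFC V) : DQFC V

/-- Team semantics over a `τ`-structure `(A, c)` where `c` interprets the two
constant symbols. -/
def CSat {V A : Type} (c : Bool → A) : Set (V → A) → DQFC V → Prop
  | T, .eq t u => ∀ s ∈ T, t.val c s = u.val c s
  | T, .neq t u => ∀ s ∈ T, t.val c s ≠ u.val c s
  | T, .dep _ ys z => ∀ s₁ ∈ T, ∀ s₂ ∈ T, (∀ i, s₁ (ys i) = s₂ (ys i)) → s₁ z = s₂ z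
  | T, .and φ ψ => CSat c T φ ∧ CSat c T ψ
  | T, .or φ ψ => ∃ T₁ T₂, T = T₁ ∪ T₂ ∧ CSat c T₁ φ ∧ CSat c T₂ ψ

/-- `k`-coherence of a `DQFC`-formula, over all `τ`-structures. -/
def CKCoherent {n : ℕ} (k : ℕ) (φ : DQFC (Fin n)) : Prop :=
  ∀ (A : Type) [Nonempty A] (c : Bool → A) (T : Set (Fin n → A)),
    CSat c T φ ↔ ∀ S ⊆ T, S.Finite → S.ncard ≤ k → CSat c S φ

/-- The translation `φ ↦ φ*`: `pᵢ ↦ (x_{pᵢ} = 1)`, `¬pᵢ ↦ (x_{pᵢ} = 0)`, dependence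
atoms are translated verbatim. -/
def PDL.trans {n : ℕ} : PDL (Fin n) → DQFC (Fin n)
  | .var p => .eq (.var p) (.const true)
  | .nvar p => .eq (.var p) (.const false)
  | .dep m ps q => .dep m ps q
  | .and φ ψ => .and (PDL.trans φ) (PDL.trans ψ)
  | .or φ ψ => .or (PDL.trans φ) (PDL.trans ψ)

/-- Conjunction of a nonempty list of formulas (with a default for the empty list). -/
def andListC {V : Type} (default : DQFC V) : List (DQFC V) → DQFC V
  | [] => default
  | [ψ] => ψ
  | ψ :: l => .and ψ (andListC default l)

/-- The formula `ψ_φ := φ* ∧ ⋀_{i=1}^{n} (x_{pᵢ} = 1 ∨ x_{pᵢ} = 0) ∧ ¬ 0 = 1`. -/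
def psiOf {n : ℕ} (φ : PDL (Fin n)) : DQFC (Fin n) :=
  .and (PDL.trans φ)
    (.and
      (andListC (.eq (.const true) (.const true))
        ((List.finRange n).map fun i =>
          .or (.eq (.var i) (.const true)) (.eq (.var i) (.const false))))
      (.neq (.const false) (.const true)))

theorem csat_empty {V A : Type} (c : Bool → A) (φ : DQFC V) : CSat c ∅ φ := by
  induction φ with
  | eq t u => simp [CSat]
  | neq t u => simp [CSat]
  | dep m ys z => simp [CSat]
  | and φ ψ h1 h2 => exact ⟨h1, h2⟩
  | or φ ψ h1 h2 => exact ⟨∅, ∅, by simp, h1, h2⟩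

theorem csat_trans {n : ℕ} {A : Type} (c : Bool → A) (hc : Function.Injective c)
    (φ : PDL (Fin n)) : ∀ T : Set (Fin n → Bool),
    CSat c ((fun s => c ∘ s) '' T) φ.trans ↔ PSat T φ := by
  have hf : Function.Injective (fun s : Fin n → Bool => c ∘ s) := hc.comp_left
  induction φ with
  | var p => intro T; simp [CSat, PSat, PDL.trans, CTerm.val, hc.eq_iff]
  | nvar p => intro T; simp [CSat, PSat, PDL.trans, CTerm.val, hc.eq_iff]
  | dep m ys z => intro T; simp [CSat, PSat, PDL.trans, hc.eq_iff]
  | and φ ψ h1 h2 => intro T; simp [CSat, PSat, PDL.trans, h1, h2]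
  | or φ ψ h1 h2 =>
    intro T
    simp only [CSat, PSat, PDL.trans]
    constructor
    · rintro ⟨T₁, T₂, h, a, b⟩
      obtain ⟨U₁, -, rfl⟩ := Set.subset_image_iff.1 (h ▸ Set.subset_union_left : T₁ ⊆ _)
      obtain ⟨U₂, -, rfl⟩ := Set.subset_image_iff.1 (h ▸ Set.subset_union_right : T₂ ⊆ _)
      rw [← Set.image_union] at h
      exact ⟨U₁, U₂, hf.image_injective h, (h1 _).1 a, (h2 _).1 b⟩
    · rintro ⟨T₁, T₂, rfl, a, b⟩
      exact ⟨_, _, Set.image_union _ _ _, (h1 _).2 a, (h2 _).2 b⟩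

theorem csat_andList {V A : Type} (c : Bool → A) (T : Set (V → A)) (d : DQFC V)
    (hd : CSat c T d) (l : List (DQFC V)) :
    CSat c T (andListC d l) ↔ ∀ ψ ∈ l, CSat c T ψ := by
  induction l with
  | nil => simpa [andListC] using hd
  | cons a l ih =>
    cases l with
    | nil => simp [andListC]
    | cons b l => rw [andListC, CSat, ih]; simp; simp

theorem csat_bool {V A : Type} (c : Bool → A) (T : Set (V → A)) (i : V) :
    CSat c T (.or (.eq (.var i) (.const true)) (.eq (.var i) (.const false))) ↔
      ∀ s ∈ T, ∃ b, s i = c b := by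
  simp only [CSat, CTerm.val]
  constructor
  · rintro ⟨T₁, T₂, rfl, a, b⟩ s (h | h)
    · exact ⟨_, a s h⟩
    · exact ⟨_, b s h⟩
  · intro h
    refine ⟨{s ∈ T | s i = c true}, {s ∈ T | s i = c false}, ?_, fun s hs => hs.2,
      fun s hs => hs.2⟩
    ext s
    constructor
    · intro hs
      obtain ⟨b, hb⟩ := h s hs
      cases b
      · exact Or.inr ⟨hs, hb⟩
      · exact Or.inl ⟨hs, hb⟩
    · rintro (h | h) <;> exact h.1

theorem csat_psi {n : ℕ} {A : Type} (c : Bool → A) (T : Set (Fin n → A)) (φ : PDL (Fin n)) :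
    CSat c T (psiOf φ) ↔ CSat c T φ.trans ∧ (∀ i, ∀ s ∈ T, ∃ b, s i = c b) ∧
      ∀ s ∈ T, c false ≠ c true := by
  rw [psiOf, CSat, CSat, csat_andList _ _ _ (by simp [CSat])]
  simp only [List.forall_mem_map, csat_bool, List.mem_finRange, true_imp_iff]
  rfl

theorem csat_psi_image {n : ℕ} {A : Type} (c : Bool → A) (hc : Function.Injective c)
    (φ : PDL (Fin n)) (T : Set (Fin n → Bool)) :
    CSat c ((fun s => c ∘ s) '' T) (psiOf φ) ↔ PSat T φ := by
  rw [csat_psi, csat_trans c hc]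
  refine and_iff_left ⟨?_, fun _ _ h => by simpa using hc h⟩
  rintro i _ ⟨s, -, rfl⟩
  exact ⟨s i, rfl⟩

theorem coh_image {n : ℕ} {A : Type} (k : ℕ) (c : Bool → A) (hc : Function.Injective c)
    (φ : PDL (Fin n)) (T : Set (Fin n → Bool)) :
    (∀ S ⊆ (fun s => c ∘ s) '' T, S.Finite → S.ncard ≤ k → CSat c S (psiOf φ)) ↔
    ∀ S ⊆ T, S.Finite → S.ncard ≤ k → PSat S φ := by
  have hf : Function.Injective (fun s : Fin n → Bool => c ∘ s) := hc.comp_left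
  constructor
  · intro h S hS hF hk
    exact (csat_psi_image c hc φ S).1
      (h _ (Set.image_mono hS) (hF.image _) (by rwa [Set.ncard_image_of_injective _ hf]))
  · intro h S hS hF hk
    obtain ⟨U, hU, rfl⟩ := Set.subset_image_iff.1 hS
    rw [Set.ncard_image_of_injective _ hf] at hk
    exact (csat_psi_image c hc φ U).2 (h U hU (hF.of_finite_image hf.injOn) hk)

/-- For every `k ≥ 1` and every PDL formula `φ(p₁,…,pₙ)` (`n ≥ 1`):
`φ` is `k`-coherent as a propositional formula iff `ψ_φ` is `k`-coherent as a
quantifier-free dependence logic formula over the vocabulary `τ = {0, 1}`. -/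
theorem stmt19 (n k : ℕ) (hn : 1 ≤ n) (hk : 1 ≤ k) (φ : PDL (Fin n)) :
    PKCoherent k φ ↔ CKCoherent k (psiOf φ) := by
  constructor
  · intro h A _ c T
    by_cases hT : T = ∅
    · subst hT
      refine iff_of_true (csat_empty _ _) fun S hS _ _ => ?_
      rw [Set.subset_empty_iff.1 hS]
      exact csat_empty _ _
    by_cases hg : Function.Injective c ∧ ∀ s ∈ T, ∀ i, ∃ b, s i = c b
    · obtain ⟨hc, hb⟩ := hg
      obtain ⟨U, rfl⟩ : ∃ U, T = (fun s : Fin n → Bool => c ∘ s) '' U := by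
        refine ⟨(fun s => c ∘ s) ⁻¹' T, ?_⟩
        rw [Set.image_preimage_eq_of_subset]
        intro s hs
        choose g hg using hb s hs
        exact ⟨g, (funext hg).symm⟩
      rw [csat_psi_image c hc, coh_image k c hc]
      exact h U
    · have inj : c false ≠ c true → Function.Injective c := by
        intro hne a b hab
        cases a <;> cases b <;> simp_all
      refine iff_of_false (fun hs => hg ?_) (fun hs => hg ?_)
      · rw [csat_psi] at hs
        obtain ⟨s, hs'⟩ := Set.nonempty_iff_ne_empty.2 hT
        exact ⟨inj (hs.2.2 s hs'), fun s hs' i => hs.2.1 i s hs'⟩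
      · have key : ∀ s ∈ T, CSat c {s} (psiOf φ) := fun s hs' =>
          hs {s} (by simpa using hs') (Set.finite_singleton s) (by simpa using hk)
        simp only [csat_psi] at key
        obtain ⟨s, hs'⟩ := Set.nonempty_iff_ne_empty.2 hT
        exact ⟨inj ((key s hs').2.2 s rfl), fun s hs' i => (key s hs').2.1 i s rfl⟩
  · intro h T
    have := h Bool id ((fun s => id ∘ s) '' T)
    rwa [csat_psi_image id Function.injective_id, coh_image k id Function.injective_id] at this
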